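/- Let p > 3 be a prime with p ≡ 1 mod 3 and let α ∈ F_p((1/T)) be the unique root of (9/32)X^4 - TX^3 + X^2 - 8/27 = 0. Then α is hyperquadratic of exponent p: there exist polynomials A, B, C, D ∈ F_p[T], not all zero, such that α = (Aα^p + B)/(Cα^p + D) nontrivially. -/

import Mathlib

open Polynomial

/-- `T = 1/X` in the Laurent series field `F((X)) = F_p((1/T))`. -/
noncomputable def Tvar (F : Type*) [Field F] : LaurentSeries F := HahnSeries.single (-1) 1

/-- For a quartic with vanishing invariant `e₂² - 3e₁e₃ + 12e₄`, the cross-ratio of its distinct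
roots is fixed by the Frobenius map when `p ≡ 1 mod 3`. -/
lemma frobenius_crossRatio_of_equianharmonic {K : Type*} [Field K] (p : ℕ) [Fact p.Prime]
    [CharP K p] (hp3 : p % 3 = 1) {a b c d : K} (hab : a ≠ b) (hcd : c ≠ d)
    (hI : (a * b + a * c + a * d + b * c + b * d + c * d) ^ 2
      - 3 * (a + b + c + d) * (a * b * c + a * b * d + a * c * d + b * c * d)
      + 12 * (a * b * c * d) = 0) :
    (a ^ p - c ^ p) * (d ^ p - b ^ p) * ((a - b) * (c - d))
      = (a ^ p - b ^ p) * (c ^ p - d ^ p) * ((a - c) * (d - b)) := by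
  have hP : (a - b) * (c - d) ≠ 0 := mul_ne_zero (sub_ne_zero.2 hab) (sub_ne_zero.2 hcd)
  obtain ⟨z, hz⟩ : ∃ z, (a - c) * (d - b) = z * ((a - b) * (c - d)) :=
    ⟨_, (div_mul_cancel₀ _ hP).symm⟩
  have hz2 : z ^ 2 + z + 1 = 0 := by
    refine (mul_eq_zero.1 ?_).resolve_right (pow_ne_zero 2 hP)
    linear_combination hI - ((a - c) * (d - b) + z * ((a - b) * (c - d)) + (a - b) * (c - d)) * hz
  have hz3 : z ^ 3 = 1 := by linear_combination (z - 1) * hz2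
  have hzp : z ^ p = z := by
    rw [← Nat.div_add_mod p 3, hp3, pow_add, pow_mul, hz3, one_pow, one_mul, pow_one]
  rw [← sub_pow_char, ← sub_pow_char, ← sub_pow_char, ← sub_pow_char, ← mul_pow, ← mul_pow, hz,
    mul_pow, hzp]
  ring

/-- The obstruction to writing `g(x)` as a Möbius transform of `x` at the roots of a quartic
vanishes if `g` preserves the cross-ratio of these roots. -/
lemma cubic_condition_of_crossRatio_eq {K : Type*} [Field K] {a b c d : K} (hab : a ≠ b)
    (hac : a ≠ c) (had : a ≠ d) (hbc : b ≠ c) (hbd : b ≠ d) (hcd : c ≠ d) (u₀ u₁ u₂ u₃ : K)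
    {g : K → K} (hg : ∀ x, g x = u₀ + u₁ * x + u₂ * x ^ 2 + u₃ * x ^ 3)
    (h : (g a - g c) * (g d - g b) * ((a - b) * (c - d))
      = (g a - g b) * (g c - g d) * ((a - c) * (d - b))) :
    u₃ * (u₁ - u₃ * (a * b + a * c + a * d + b * c + b * d + c * d))
      - u₂ * (u₂ + u₃ * (a + b + c + d)) = 0 := by
  have hV : (a - b) * (c - d) * ((a - c) * (d - b)) * ((a - d) * (b - c)) ≠ 0 := by
    simp [sub_eq_zero, hab, hac, had, hbc, hbd.symm, hcd]
  refine (mul_eq_zero.1 ?_).resolve_left hV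
  simp only [hg] at h
  linear_combination -h

/-- The root-coefficient relations of a split monic quartic. -/
lemma exists_quartic_roots {K : Type*} [Field K] [IsAlgClosed K] (e₁ e₂ e₃ e₄ : K) :
    ∃ a b c d : K, a + b + c + d = e₁ ∧ a * b + a * c + a * d + b * c + b * d + c * d = e₂ ∧
      a * b * c + a * b * d + a * c * d + b * c * d = e₃ ∧ a * b * c * d = e₄ := by
  set f : K[X] := X ^ 4 - C e₁ * X ^ 3 + C e₂ * X ^ 2 - C e₃ * X + C e₄ with hf
  have hdeg : f.natDegree = 4 := by rw [hf]; compute_degree!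
  have hmonic : f.Monic := by rw [hf]; monicity!
  have hcard : f.roots.card = 4 := by rw [IsAlgClosed.card_roots_eq_natDegree, hdeg]
  obtain ⟨a, b, c, d, hr⟩ := Multiset.card_eq_four.1 hcard
  have hprod := (IsAlgClosed.splits f).eq_prod_roots_of_monic hmonic
  have hexp : f = X ^ 4 - C (a + b + c + d) * X ^ 3
      + C (a * b + a * c + a * d + b * c + b * d + c * d) * X ^ 2
      - C (a * b * c + a * b * d + a * c * d + b * c * d) * X + C (a * b * c * d) := by
    rw [hprod, hr]
    simp only [Multiset.insert_eq_cons, Multiset.map_cons, Multiset.map_singleton,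
      Multiset.prod_cons, Multiset.prod_singleton, map_add, map_mul]
    ring
  rw [hf] at hexp
  refine ⟨a, b, c, d, ?_⟩
  generalize a + b + c + d = s₁, a * b + a * c + a * d + b * c + b * d + c * d = s₂,
    a * b * c + a * b * d + a * c * d + b * c * d = s₃, a * b * c * d = s₄ at hexp ⊢
  have hcoeff (n : ℕ) := congrArg (coeff · n) hexp.symm
  refine ⟨?_, ?_, ?_, ?_⟩
  · simpa [coeff_X, coeff_C] using hcoeff 3
  · simpa [coeff_X, coeff_C] using hcoeff 2
  · simpa [coeff_X, coeff_C] using hcoeff 1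
  · simpa [coeff_X, coeff_C] using hcoeff 0

/-- In characteristic `p ≡ 1 mod 3`, a separable monic quartic with vanishing invariant
`e₂² - 3e₁e₃ + 12e₄` divides a polynomial of the form `C X ^ (p + 1) + D X - A X ^ p - B`. -/
theorem exists_quartic_dvd {R Ω : Type*} [CommRing R] [Nontrivial R] [Field Ω] [IsAlgClosed Ω]
    (p : ℕ) [Fact p.Prime] [CharP Ω p] (hp3 : p % 3 = 1) {φ : R →+* Ω}
    (hφ : Function.Injective φ) (e₁ e₂ e₃ e₄ : R) (hI : e₂ ^ 2 - 3 * e₁ * e₃ + 12 * e₄ = 0)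
    (hsep : ∀ x : Ω, x ^ 4 - φ e₁ * x ^ 3 + φ e₂ * x ^ 2 - φ e₃ * x + φ e₄ = 0 →
      4 * x ^ 3 - 3 * φ e₁ * x ^ 2 + 2 * φ e₂ * x - φ e₃ ≠ 0) :
    ∃ A B C' D : R, ¬ (A = 0 ∧ B = 0 ∧ C' = 0 ∧ D = 0) ∧
      X ^ 4 - C e₁ * X ^ 3 + C e₂ * X ^ 2 - C e₃ * X + C e₄ ∣
        X * (C C' * X ^ p + C D) - (C A * X ^ p + C B) := by
  set f : R[X] := X ^ 4 - C e₁ * X ^ 3 + C e₂ * X ^ 2 - C e₃ * X + C e₄ with hf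
  have hdeg : f.natDegree = 4 := by rw [hf]; compute_degree!
  have hmonic : f.Monic := by rw [hf]; monicity!
  obtain ⟨u₀, u₁, u₂, u₃, q, hq⟩ : ∃ u₀ u₁ u₂ u₃ : R, ∃ q : R[X],
      X ^ p = C u₀ + C u₁ * X + C u₂ * X ^ 2 + C u₃ * X ^ 3 + f * q := by
    have hgdeg : (X ^ p %ₘ f).natDegree < 4 :=
      hdeg ▸ natDegree_modByMonic_lt _ hmonic (fun h => by simp [h] at hdeg)
    refine ⟨(X ^ p %ₘ f).coeff 0, (X ^ p %ₘ f).coeff 1, (X ^ p %ₘ f).coeff 2,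
      (X ^ p %ₘ f).coeff 3, X ^ p /ₘ f, ?_⟩
    conv_lhs => rw [← modByMonic_add_div (X ^ p) f, as_sum_range_C_mul_X_pow' _ hgdeg]
    simp only [Finset.sum_range_succ, Finset.sum_range_zero, zero_add, pow_zero, mul_one, pow_one]
  obtain ⟨a, b, c, d, h₁, h₂, h₃, h₄⟩ := exists_quartic_roots (φ e₁) (φ e₂) (φ e₃) (φ e₄)
  have hroot (x : Ω) (hx : (x - a) * (x - b) * (x - c) * (x - d) = 0) :
      x ^ 4 - φ e₁ * x ^ 3 + φ e₂ * x ^ 2 - φ e₃ * x + φ e₄ = 0 := by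
    rw [← h₁, ← h₂, ← h₃, ← h₄]
    linear_combination hx
  have hpow (x : Ω) (hx : (x - a) * (x - b) * (x - c) * (x - d) = 0) :
      φ u₀ + φ u₁ * x + φ u₂ * x ^ 2 + φ u₃ * x ^ 3 = x ^ p := by
    have hfx : eval₂ φ x f = 0 := by simpa [hf] using hroot x hx
    simpa [hfx] using (congrArg (eval₂ φ x) hq).symm
  have hne (x : Ω) (hx : (x - a) * (x - b) * (x - c) * (x - d) = 0)
      (h : (x - a) * (x - b) * (x - c) + (x - a) * (x - b) * (x - d) + (x - a) * (x - c) * (x - d)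
        + (x - b) * (x - c) * (x - d) = 0) : False := by
    refine hsep x (hroot x hx) ?_
    rw [← h₁, ← h₂, ← h₃]
    linear_combination h
  have hab : a ≠ b := by rintro rfl; exact hne a (by ring) (by ring)
  have hac : a ≠ c := by rintro rfl; exact hne a (by ring) (by ring)
  have had : a ≠ d := by rintro rfl; exact hne a (by ring) (by ring)
  have hbc : b ≠ c := by rintro rfl; exact hne b (by ring) (by ring)
  have hbd : b ≠ d := by rintro rfl; exact hne b (by ring) (by ring)
  have hcd : c ≠ d := by rintro rfl; exact hne c (by ring) (by ring)
  have hΔ : u₃ * (u₁ - u₃ * e₂) - u₂ * (u₂ + u₃ * e₁) = 0 := by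
    apply hφ
    have h := frobenius_crossRatio_of_equianharmonic p hp3 hab hcd (by
      rw [h₁, h₂, h₃, h₄]
      simpa only [map_add, map_sub, map_mul, map_pow, map_ofNat, map_zero] using congrArg φ hI)
    rw [← hpow a (by ring), ← hpow b (by ring), ← hpow c (by ring), ← hpow d (by ring)] at h
    have := cubic_condition_of_crossRatio_eq hab hac had hbc hbd hcd (φ u₀) (φ u₁) (φ u₂) (φ u₃)
      (fun _ => rfl) h
    rw [h₁, h₂] at this
    simpa using this
  by_cases h3 : u₃ = 0
  · have h2 : u₂ = 0 := by
      have : φ u₂ ^ 2 = 0 := by simpa [h3, sq] using congrArg φ hΔ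
      exact hφ (by simpa using this)
    refine ⟨1, -u₀, 0, u₁, by simp, -q, ?_⟩
    rw [h3, h2] at hq
    simp only [map_zero, map_one, map_neg] at hq ⊢
    linear_combination -hq
  · refine ⟨u₂ + u₃ * e₁, u₃ * (-u₃ * e₄) - (u₂ + u₃ * e₁) * u₀, u₃,
      -(u₃ * (u₀ + u₃ * e₃)) + (u₂ + u₃ * e₁) * u₁, by simp [h3],
      C u₃ * (X * q + C u₃) - C (u₂ + u₃ * e₁) * q, ?_⟩
    have hΔC := congrArg C hΔ
    simp only [map_add, map_sub, map_mul, map_neg, map_zero] at hΔC ⊢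
    linear_combination (C u₃ * X - (C u₂ + C u₃ * C e₁)) * hq + X ^ 2 * hΔC
      - C u₃ ^ 2 * hf

lemma sq_eq_one_of_double_root {K : Type*} [Field K] (h2 : (2 : K) ≠ 0) {x t : K}
    (hx : 243 * x ^ 4 - 864 * t * x ^ 3 + 864 * x ^ 2 - 256 = 0)
    (hx' : 9 * x ^ 3 - 24 * t * x ^ 2 + 16 * x = 0) : t ^ 2 = 1 := by
  have h3 : (3 : K) ≠ 0 := by
    intro h3
    refine pow_ne_zero 8 h2 ?_
    linear_combination -hx + (81 * x ^ 4 - 288 * t * x ^ 3 + 288 * x ^ 2) * h3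
  have hx0 : x ≠ 0 := by
    rintro rfl
    refine pow_ne_zero 8 h2 ?_
    linear_combination -hx
  have hsq : 9 * x ^ 2 - 16 = 0 := by
    refine pow_eq_zero_iff two_ne_zero |>.1 ?_
    linear_combination -hx + 36 * x * hx'
  have htx : 3 * t * x = 4 := by
    refine mul_left_cancel₀ (pow_ne_zero 3 h2) (mul_left_cancel₀ hx0 ?_)
    linear_combination -hx' + x * hsq
  refine mul_left_cancel₀ (pow_ne_zero 4 h2) ?_
  linear_combination (3 * t * x + 4) * htx - t ^ 2 * hsq

lemma Tvar_pow (F : Type*) [Field F] (n : ℕ) :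
    Tvar F ^ n = HahnSeries.single (-(n : ℤ)) 1 := by
  simp [Tvar, HahnSeries.single_pow]

lemma coeff_aeval_Tvar {F : Type*} [Field F] (P : F[X]) (n : ℕ) :
    (aeval (Tvar F) P).coeff (-(n : ℤ)) = P.coeff n := by
  induction P using Polynomial.induction_on' with
  | add P Q hP hQ => simp [hP, hQ]
  | monomial m a =>
    rw [aeval_monomial, Tvar_pow, LaurentSeries.algebraMap_apply, HahnSeries.C_mul_eq_smul,
      HahnSeries.coeff_smul, coeff_monomial, HahnSeries.coeff_single]
    simp [eq_comm]

lemma aeval_Tvar_injective (F : Type*) [Field F] :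
    Function.Injective (aeval (Tvar F) : F[X] →ₐ[F] LaurentSeries F) := by
  intro P Q h
  ext n
  rw [← coeff_aeval_Tvar, h, coeff_aeval_Tvar]

lemma not_rational_root {F : Type*} [Field F] (h2 : (2 : F) ≠ 0) (h3 : (3 : F) ≠ 0) {P Q : F[X]}
    (hQ : Q ≠ 0)
    (h : 243 * P ^ 4 - 864 * X * P ^ 3 * Q + 864 * P ^ 2 * Q ^ 2 - 256 * Q ^ 4 = 0) : False := by
  obtain ⟨g, P, Q, rfl, rfl, hco⟩ : ∃ g P' Q', g * P' = P ∧ g * Q' = Q ∧ IsCoprime P' Q' := by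
    classical
    let := EuclideanDomain.gcdMonoid F[X]
    obtain ⟨P', Q', hP, hQ, hu⟩ := extract_gcd P Q
    exact ⟨_, P', Q', hP.symm, hQ.symm, (gcd_isUnit_iff _ _).1 hu⟩
  have hg : g ≠ 0 := left_ne_zero_of_mul hQ
  replace h : 243 * P ^ 4 - 864 * X * P ^ 3 * Q + 864 * P ^ 2 * Q ^ 2 - 256 * Q ^ 4 = 0 := by
    refine (mul_eq_zero.1 ?_).resolve_left (pow_ne_zero 4 hg)
    linear_combination h
  have h3u : IsUnit (243 : F[X]) := by
    have : (243 : F[X]) = C (3 ^ 5) := by rw [map_pow, map_ofNat]; norm_num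
    exact this ▸ isUnit_C.2 (pow_ne_zero 5 h3).isUnit
  have h2u : IsUnit (256 : F[X]) := by
    have : (256 : F[X]) = C (2 ^ 8) := by rw [map_pow, map_ofNat]; norm_num
    exact this ▸ isUnit_C.2 (pow_ne_zero 8 h2).isUnit
  have hPu : IsUnit P := by
    have : P ∣ Q ^ 4 * 256 :=
      ⟨243 * P ^ 3 - 864 * X * P ^ 2 * Q + 864 * P * Q ^ 2, by linear_combination -h⟩
    exact hco.pow_right.isUnit_of_dvd' dvd_rfl (h2u.dvd_mul_right.1 this)
  have hQu : IsUnit Q := by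
    have : Q ∣ P ^ 4 * 243 :=
      ⟨864 * X * P ^ 3 - 864 * P ^ 2 * Q + 256 * Q ^ 3, by linear_combination h⟩
    exact hco.pow_left.isUnit_of_dvd' (h3u.dvd_mul_right.1 this) dvd_rfl
  obtain ⟨u, hu, rfl⟩ := Polynomial.isUnit_iff.1 hPu
  obtain ⟨v, hv, rfl⟩ := Polynomial.isUnit_iff.1 hQu
  have hX : C (243 * u ^ 4 + 864 * u ^ 2 * v ^ 2 - 256 * v ^ 4)
      - C (2 ^ 5 * 3 ^ 3 * u ^ 3 * v) * X = 0 := by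
    simp only [map_sub, map_add, map_mul, map_pow, map_ofNat]
    linear_combination h
  have hX1 : (2 : F) ^ 5 * 3 ^ 3 * u ^ 3 * v = 0 := by
    have := congrArg (coeff · 1) hX
    simpa only [coeff_sub, coeff_C_mul, coeff_X_one, mul_one, coeff_C_succ, zero_sub, coeff_zero,
      neg_eq_zero] using this
  simp [h2, h3, hu.ne_zero, hv.ne_zero] at hX1

/-- For `p > 3` prime with `p ≡ 1 mod 3`, the unique root `α ∈ F_p((1/T))` of
`(9/32)X⁴ - TX³ + X² - 8/27 = 0` is hyperquadratic of exponent `p`: `α` is irrational and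
`α(Cαᵖ + D) = Aαᵖ + B` for polynomials `A, B, C, D ∈ F_p[T]` not all zero. -/
theorem RQE_root_hyperquadratic (p : ℕ) [Fact p.Prime] (hp : 3 < p) (hp3 : p % 3 = 1)
    (α : LaurentSeries (ZMod p))
    (hα : (9 / 32) * α ^ 4 - Tvar (ZMod p) * α ^ 3 + α ^ 2 - 8 / 27 = 0)
    (hαu : ∀ γ : LaurentSeries (ZMod p),
      (9 / 32) * γ ^ 4 - Tvar (ZMod p) * γ ^ 3 + γ ^ 2 - 8 / 27 = 0 → γ = α) :
    (¬ ∃ P Q : Polynomial (ZMod p), Q ≠ 0 ∧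
        α * aeval (Tvar (ZMod p)) Q = aeval (Tvar (ZMod p)) P) ∧
      ∃ A B C D : Polynomial (ZMod p), ¬ (A = 0 ∧ B = 0 ∧ C = 0 ∧ D = 0) ∧
        α * (aeval (Tvar (ZMod p)) C * α ^ p + aeval (Tvar (ZMod p)) D) =
          aeval (Tvar (ZMod p)) A * α ^ p + aeval (Tvar (ZMod p)) B := by
  have hF (n : ℕ) (hn0 : 0 < n) (hn : n < p) : (n : ZMod p) ≠ 0 := by
    rw [Ne, ZMod.natCast_eq_zero_iff]
    exact Nat.not_dvd_of_pos_of_lt hn0 hn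
  have h2 : (2 : ZMod p) ≠ 0 := by exact_mod_cast hF 2 (by lia) (by lia)
  have h3 : (3 : ZMod p) ≠ 0 := by exact_mod_cast hF 3 (by lia) hp
  have h2L : (2 : LaurentSeries (ZMod p)) ≠ 0 := by
    rw [← map_ofNat (algebraMap (ZMod p) (LaurentSeries (ZMod p))) 2]
    exact (_root_.map_ne_zero _).2 h2
  have h3L : (3 : LaurentSeries (ZMod p)) ≠ 0 := by
    rw [← map_ofNat (algebraMap (ZMod p) (LaurentSeries (ZMod p))) 3]
    exact (_root_.map_ne_zero _).2 h3
  have h32L : (32 : LaurentSeries (ZMod p)) ≠ 0 := by convert pow_ne_zero 5 h2L; norm_num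
  have h27L : (27 : LaurentSeries (ZMod p)) ≠ 0 := by convert pow_ne_zero 3 h3L; norm_num
  have h243L : (243 : LaurentSeries (ZMod p)) ≠ 0 := by convert pow_ne_zero 5 h3L; norm_num
  replace hα : 243 * α ^ 4 - 864 * Tvar (ZMod p) * α ^ 3 + 864 * α ^ 2 - 256 = 0 := by
    field_simp at hα
    linear_combination hα
  have hinj := aeval_Tvar_injective (ZMod p)
  refine ⟨fun ⟨P, Q, hQ, h⟩ => not_rational_root h2 h3 hQ (P := P) (hinj ?_), ?_⟩
  · simp only [map_sub, map_add, map_mul, map_pow, map_ofNat, map_zero, aeval_X, ← h]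
    linear_combination aeval (Tvar (ZMod p)) Q ^ 4 * hα
  obtain ⟨k, hk⟩ : ∃ k : ZMod p, 9 * k = 32 :=
    ⟨32 / 9, mul_div_cancel₀ _ (by convert pow_ne_zero 2 h3; norm_num)⟩
  obtain ⟨m, hm⟩ : ∃ m : ZMod p, 243 * m = -256 :=
    ⟨-256 / 243, mul_div_cancel₀ _ (by convert pow_ne_zero 5 h3; norm_num)⟩
  let φ := (algebraMap (LaurentSeries (ZMod p)) (AlgebraicClosure (LaurentSeries (ZMod p)))).comp
    (aeval (Tvar (ZMod p)) : (ZMod p)[X] →ₐ[ZMod p] _).toRingHom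
  have hφ : Function.Injective φ :=
    (algebraMap (LaurentSeries (ZMod p)) (AlgebraicClosure (LaurentSeries (ZMod p)))).injective.comp
      hinj
  have : CharP (AlgebraicClosure (LaurentSeries (ZMod p))) p :=
    charP_of_injective_ringHom (f := φ.comp C) (RingHom.injective _) p
  have h2Ω : (2 : AlgebraicClosure (LaurentSeries (ZMod p))) ≠ 0 := by
    rw [← map_ofNat (φ.comp C) 2]
    exact (_root_.map_ne_zero _).2 h2
  have hkC : (9 : (ZMod p)[X]) * C k = 32 := by
    simpa only [map_mul, map_ofNat] using congrArg C hk
  have hmC : (243 : (ZMod p)[X]) * C m = -256 := by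
    simpa only [map_mul, map_neg, map_ofNat] using congrArg C hm
  obtain ⟨A, B, C', D, h0, hdvd⟩ := exists_quartic_dvd p hp3 hφ (C k * X) (C k) 0 (C m) (by
    have h3C : (C (3 ^ 5) : (ZMod p)[X]) ≠ 0 := C_ne_zero.2 (pow_ne_zero 5 h3)
    refine mul_left_cancel₀ h3C ?_
    simp only [map_pow, map_ofNat]
    linear_combination (27 * C k + 96) * hkC + 12 * hmC) (by
    intro x hx hx'
    have hkφ : 9 * φ (C k) = 32 := by simpa only [map_mul, map_ofNat] using congrArg φ hkC
    have hmφ : 243 * φ (C m) = -256 := by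
      simpa only [map_mul, map_neg, map_ofNat] using congrArg φ hmC
    rw [map_mul, map_zero] at hx hx'
    have h1 := sq_eq_one_of_double_root h2Ω (x := x) (t := φ X)
      (by linear_combination 243 * hx + (27 * φ X * x ^ 3 - 27 * x ^ 2) * hkφ - hmφ)
      (by
        refine mul_left_cancel₀ (pow_ne_zero 2 h2Ω) ?_
        linear_combination 9 * hx' + (3 * φ X * x ^ 2 - 2 * x) * hkφ)
    rw [← map_pow, ← map_one φ] at h1
    simpa using congrArg natDegree (hφ h1))
  refine ⟨A, B, C', D, h0, ?_⟩
  have hkα := congrArg (aeval (Tvar (ZMod p))) hkC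
  have hmα := congrArg (aeval (Tvar (ZMod p))) hmC
  simp only [map_mul, map_neg, map_ofNat] at hkα hmα
  obtain ⟨q, hq⟩ := hdvd
  have hev := congrArg (eval₂ (aeval (Tvar (ZMod p)) : (ZMod p)[X] →ₐ[ZMod p] _).toRingHom α) hq
  simp only [eval₂_mul, eval₂_sub, eval₂_add, eval₂_pow, eval₂_X, eval₂_C, AlgHom.toRingHom_eq_coe,
    RingHom.coe_coe, map_mul, aeval_X, map_zero, eval₂_zero] at hev
  have hroot : α ^ 4 - aeval (Tvar (ZMod p)) (C k) * Tvar (ZMod p) * α ^ 3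
      + aeval (Tvar (ZMod p)) (C k) * α ^ 2 - 0 * α + aeval (Tvar (ZMod p)) (C m) = 0 := by
    refine mul_left_cancel₀ h243L ?_
    linear_combination hα + (-27 * Tvar (ZMod p) * α ^ 3 + 27 * α ^ 2) * hkα + hmα
  rw [hroot, zero_mul] at hev
  exact sub_eq_zero.1 hev
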